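/- Let n ≥ 2, 1 < p < n, 0 < q < p−1, and 0 < r ≤ n(p−1)/(n−p), and let σ be a locally finite nonnegative Borel measure on ℝⁿ. If K_{1,p,q}σ ∈ L^r(ℝⁿ), then σ = 0. -/

import Mathlib

open MeasureTheory Metric Set
open scoped ENNReal NNReal

/-- The Wolff potential `W_{α,p}ν(x) = ∫₀^∞ (ν(B(x,ρ))/ρ^{n−αp})^{1/(p−1)} dρ/ρ`. -/
noncomputable def wolffPot (n : ℕ) (α p : ℝ)
    (ν : Measure (EuclideanSpace ℝ (Fin n))) (x : EuclideanSpace ℝ (Fin n)) : ℝ≥0∞ :=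
  ∫⁻ ρ in Set.Ioi (0 : ℝ),
    (ν (Metric.ball x ρ) / ENNReal.ofReal (ρ ^ ((n : ℝ) - α * p))) ^ (1 / (p - 1)) /
      ENNReal.ofReal ρ

/-- The least constant `κ(E)` such that
`(∫_E (W_{α,p}ν)^q dσ)^{1/q} ≤ κ · ν(ℝⁿ)^{1/(p−1)}` for all finite measures `ν`. -/
noncomputable def embC (n : ℕ) (α p q : ℝ) (σ : Measure (EuclideanSpace ℝ (Fin n)))
    (E : Set (EuclideanSpace ℝ (Fin n))) : ℝ≥0∞ :=
  sInf {κ : ℝ≥0∞ | ∀ ν : Measure (EuclideanSpace ℝ (Fin n)), IsFiniteMeasure ν →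
    (∫⁻ y in E, wolffPot n α p ν y ^ q ∂σ) ^ (1 / q) ≤ κ * (ν Set.univ) ^ (1 / (p - 1))}

/-- The intrinsic potential of Wolff type
`K_{α,p,q}σ(x) = ∫₀^∞ (κ(B(x,ρ))^{q(p−1)/(p−1−q)}/ρ^{n−αp})^{1/(p−1)} dρ/ρ`. -/
noncomputable def intK (n : ℕ) (α p q : ℝ) (σ : Measure (EuclideanSpace ℝ (Fin n)))
    (x : EuclideanSpace ℝ (Fin n)) : ℝ≥0∞ :=
  ∫⁻ ρ in Set.Ioi (0 : ℝ),
    (embC n α p q σ (Metric.ball x ρ) ^ (q * (p - 1) / (p - 1 - q)) /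
      ENNReal.ofReal (ρ ^ ((n : ℝ) - α * p))) ^ (1 / (p - 1)) / ENNReal.ofReal ρ

/-- Integrating over `(t, 2t)` bounds a Wolff-type integral from below. -/
theorem ofReal_le_lintegral_wolff {d β a t : ℝ} (hd : 0 ≤ d) (hβ : 0 < β) (ha : 0 < a)
    (ht : 0 < t) (g : ℝ → ℝ≥0∞) (hg : ∀ ρ, t < ρ → ENNReal.ofReal a ≤ g ρ) :
    ENNReal.ofReal ((a / (2 * t) ^ d) ^ β / 2) ≤
      ∫⁻ ρ in Ioi (0 : ℝ), (g ρ / ENNReal.ofReal (ρ ^ d)) ^ β / ENNReal.ofReal ρ := by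
  have hpos : 0 < (2 * t) ^ d := by positivity
  have hconst : ENNReal.ofReal ((a / (2 * t) ^ d) ^ β / 2) =
      ∫⁻ _ in Ioo t (2 * t),
        (ENNReal.ofReal a / ENNReal.ofReal ((2 * t) ^ d)) ^ β / ENNReal.ofReal (2 * t) := by
    rw [setLIntegral_const, Real.volume_Ioo, ← ENNReal.ofReal_div_of_pos hpos,
      ENNReal.ofReal_rpow_of_pos (by positivity), ← ENNReal.ofReal_div_of_pos (by positivity),
      ← ENNReal.ofReal_mul (by positivity)]
    congr 1
    field_simp
    ring
  calc
    _ = _ := hconst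
    _ ≤ ∫⁻ ρ in Ioo t (2 * t), (g ρ / ENNReal.ofReal (ρ ^ d)) ^ β / ENNReal.ofReal ρ := by
        refine setLIntegral_mono' measurableSet_Ioo fun ρ hρ => ?_
        have hρ0 : 0 < ρ := ht.trans hρ.1
        gcongr
        · exact hg ρ hρ.1
        · exact hρ.2.le
        · exact hρ.2.le
    _ ≤ _ := lintegral_mono_set fun ρ hρ => ht.trans hρ.1

theorem embC_mono (n : ℕ) (α p : ℝ) {q : ℝ} (hq : 0 < q)
    (σ : Measure (EuclideanSpace ℝ (Fin n))) {E F : Set (EuclideanSpace ℝ (Fin n))}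
    (hEF : E ⊆ F) : embC n α p q σ E ≤ embC n α p q σ F := by
  refine sInf_le_sInf fun κ hκ ν hν => le_trans ?_ (hκ ν hν)
  gcongr

/-- The embedding constant of a ball of positive measure is positive. -/
theorem embC_ball_pos {n : ℕ} {α p q R : ℝ} (hp : 1 < p) (hd : 0 ≤ (n : ℝ) - α * p)
    (hq : 0 < q) (hR : 0 < R) (σ : Measure (EuclideanSpace ℝ (Fin n)))
    (hσ : σ (ball 0 R) ≠ 0) : 0 < embC n α p q σ (ball 0 R) := by
  have hβ : 0 < 1 / (p - 1) := one_div_pos.2 (sub_pos.2 hp)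
  set c : ℝ := (1 / (2 * R) ^ ((n : ℝ) - α * p)) ^ (1 / (p - 1)) / 2 with hc
  have hc0 : 0 < c := by positivity
  refine lt_of_lt_of_le (b := (ENNReal.ofReal c ^ q * σ (ball 0 R)) ^ (1 / q)) ?_
    (le_sInf fun κ hκ => ?_)
  · have hcq : 0 < ENNReal.ofReal c ^ q :=
      ENNReal.rpow_pos (ENNReal.ofReal_pos.2 hc0) ENNReal.ofReal_ne_top
    rw [pos_iff_ne_zero, Ne, ENNReal.rpow_eq_zero_iff_of_pos (by positivity)]
    exact mul_ne_zero hcq.ne' hσ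
  · have h := hκ (Measure.dirac 0) inferInstance
    rw [measure_univ, ENNReal.one_rpow, mul_one] at h
    refine le_trans ?_ h
    gcongr
    rw [← setLIntegral_const]
    refine setLIntegral_mono' measurableSet_ball fun y hy => ?_
    gcongr
    refine ofReal_le_lintegral_wolff hd hβ one_pos hR _ fun ρ hρ => ?_
    have h0 : (0 : EuclideanSpace ℝ (Fin n)) ∈ ball y ρ := by
      rw [mem_ball']
      exact (mem_ball.1 hy).trans hρ
    rw [Measure.dirac_apply_of_mem h0, ENNReal.ofReal_one]

/-- The function `(R + ‖x‖) ^ (-n)` is not integrable on an `n`-dimensional space. -/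
theorem lintegral_add_norm_rpow_neg_finrank_eq_top {E : Type*} [NormedAddCommGroup E]
    [NormedSpace ℝ E] [FiniteDimensional ℝ E] [Nontrivial E] [MeasurableSpace E] [BorelSpace E]
    (μ : Measure E) [μ.IsAddHaarMeasure] {R : ℝ} (hR : 0 < R) :
    ∫⁻ x, ENNReal.ofReal ((R + ‖x‖) ^ (-(Module.finrank ℝ E : ℝ))) ∂μ = ⊤ := by
  by_contra hfin
  set n := Module.finrank ℝ E with hn
  have hn0 : 0 < n := Module.finrank_pos
  have hint : Integrable (fun x : E => (R + ‖x‖) ^ (-(n : ℝ))) μ := by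
    refine (lintegral_ofReal_ne_top_iff_integrable ?_ ?_).1 hfin
    · exact Measurable.aestronglyMeasurable (by fun_prop)
    · exact Filter.Eventually.of_forall fun x => by positivity
  have hrad := (integrable_fun_norm_addHaar μ
    (f := fun y : ℝ => (R + y) ^ (-(n : ℝ)))).1 hint
  rw [← hn] at hrad
  refine not_integrableOn_Ioi_inv (a := R) ?_
  have hradR := (hrad.mono_set (Ioi_subset_Ioi hR.le)).const_mul ((2 : ℝ) ^ n)
  refine Integrable.mono' hradR (by fun_prop) ?_
  refine (ae_restrict_iff' measurableSet_Ioi).2 (Filter.Eventually.of_forall fun y hy => ?_)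
  have hy : R < y := hy
  have hy0 : 0 < y := hR.trans hy
  rw [Real.norm_of_nonneg (by positivity), smul_eq_mul, Real.rpow_neg (by positivity),
    Real.rpow_natCast]
  have hpow : (R + y) ^ n ≤ (2 * y) ^ n := by gcongr; linarith
  obtain ⟨m, hm⟩ : ∃ m, n = m + 1 := ⟨n - 1, by omega⟩
  calc
    y⁻¹ = 2 ^ n * (y ^ (n - 1) * ((2 * y) ^ n)⁻¹) := by
        rw [hm, Nat.add_sub_cancel]
        field_simp
        ring
    _ ≤ 2 ^ n * (y ^ (n - 1) * ((R + y) ^ n)⁻¹) := by gcongr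

/-- For `1 < p < n` and `0 < r ≤ n(p−1)/(n−p)`, if `K_{1,p,q}σ ∈ L^r(ℝⁿ)`
then `σ = 0`. -/
theorem measure_eq_zero_of_intK_mem_Lr (n : ℕ) (hn : 2 ≤ n) (p q r : ℝ)
    (hp : 1 < p) (hpn : p < n) (hq0 : 0 < q) (hqp : q < p - 1)
    (hr0 : 0 < r) (hr : r ≤ (n : ℝ) * (p - 1) / ((n : ℝ) - p))
    (σ : Measure (EuclideanSpace ℝ (Fin n))) (hσloc : IsLocallyFiniteMeasure σ)
    (hK : (∫⁻ x, intK n 1 p q σ x ^ r) < ⊤) :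
    σ = 0 := by
  have hp1 : 0 < p - 1 := sub_pos.2 hp
  have hnp : 0 < (n : ℝ) - p := sub_pos.2 hpn
  have hd : 0 ≤ (n : ℝ) - 1 * p := by linarith
  by_contra hσ
  obtain ⟨R, hR1, hσR⟩ : ∃ R : ℝ, 1 ≤ R ∧ σ (ball 0 R) ≠ 0 := by
    by_contra! h
    refine hσ (Measure.measure_univ_eq_zero.1 ?_)
    rw [← iUnion_ball_nat_succ (0 : EuclideanSpace ℝ (Fin n)), measure_iUnion_null_iff]
    exact fun k => h _ (by simp)
  have hR0 : 0 < R := by linarith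
  set s : ℝ := q * (p - 1) / (p - 1 - q)
  have hs : 0 < s := div_pos (mul_pos hq0 hp1) (by linarith)
  obtain ⟨a, ha0, ha⟩ : ∃ a : ℝ, 0 < a ∧
      ENNReal.ofReal a ≤ embC n 1 p q σ (ball 0 R) ^ s := by
    have hk : 0 < embC n 1 p q σ (ball 0 R) ^ s :=
      ENNReal.rpow_pos_of_nonneg (embC_ball_pos hp hd hq0 hR0 σ hσR) hs.le
    obtain ⟨a, ha0, ha⟩ := ENNReal.lt_iff_exists_nnreal_btwn.1 hk
    exact ⟨a, by exact_mod_cast ha0, by simpa using ha.le⟩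
  set β : ℝ := 1 / (p - 1) with hβ
  have hβ0 : 0 < β := one_div_pos.2 hp1
  set e : ℝ := (n : ℝ) - 1 * p with he
  have hexp : e * β * r ≤ n := by
    have h := (le_div_iff₀ hnp).1 hr
    rw [hβ, he, one_mul, mul_one_div, div_mul_eq_mul_div, div_le_iff₀ hp1]
    linarith
  set C : ℝ := ((a / 2 ^ e) ^ β / 2) ^ r with hC
  have hC0 : 0 < C := by positivity
  have hlow : ∀ x, ENNReal.ofReal C * ENNReal.ofReal ((R + ‖x‖) ^ (-(n : ℝ))) ≤
      intK n 1 p q σ x ^ r := by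
    intro x
    have ht1 : 1 ≤ R + ‖x‖ := by linarith [norm_nonneg x]
    have ht0 : 0 < R + ‖x‖ := by linarith
    have hball : ∀ ρ, R + ‖x‖ < ρ →
        ENNReal.ofReal a ≤ embC n 1 p q σ (ball x ρ) ^ s := by
      refine fun ρ hρ => ha.trans ?_
      gcongr
      refine embC_mono n 1 p hq0 σ (ball_subset_ball' ?_)
      rw [dist_zero_left]
      exact hρ.le
    have hW := ofReal_le_lintegral_wolff hd hβ0 ha0 ht0
      (fun ρ => embC n 1 p q σ (ball x ρ) ^ s) hball
    refine le_trans ?_ (ENNReal.rpow_le_rpow hW hr0.le)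
    rw [ENNReal.ofReal_rpow_of_pos (by positivity), ← ENNReal.ofReal_mul hC0.le]
    refine ENNReal.ofReal_le_ofReal ?_
    have heq : ((a / (2 * (R + ‖x‖)) ^ e) ^ β / 2) ^ r = C * (R + ‖x‖) ^ (-(e * β * r)) := by
      rw [hC, Real.mul_rpow zero_le_two ht0.le, ← div_div, div_eq_mul_inv (a / 2 ^ e),
        ← Real.rpow_neg ht0.le, Real.mul_rpow (by positivity) (by positivity),
        ← Real.rpow_mul ht0.le, mul_div_right_comm,
        Real.mul_rpow (by positivity) (by positivity), ← Real.rpow_mul ht0.le]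
      congr 2
      ring
    rw [heq]
    gcongr
  have : Nonempty (Fin n) := ⟨⟨0, by omega⟩⟩
  have htop := lintegral_add_norm_rpow_neg_finrank_eq_top
    (volume : Measure (EuclideanSpace ℝ (Fin n))) hR0
  rw [finrank_euclideanSpace_fin] at htop
  refine hK.not_ge (le_trans ?_ (lintegral_mono hlow))
  rw [lintegral_const_mul' _ _ ENNReal.ofReal_ne_top, htop,
    ENNReal.mul_top (ENNReal.ofReal_pos.2 hC0).ne']
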